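/- Let β ∈ (0,2), a > ∑_{k=1}^∞ k^{-(β+1)}, and let X₁ be ℤ-valued with P{X₁ = k} = 1/(2a|k|^{β+1}) for k ≠ 0 and P{X₁ = 0} = 1 − (1/a)∑_{k=1}^∞ k^{-(β+1)}. Then its characteristic function satisfies φ(θ) = 1 − (π/(2a)) · |θ|^β/(Γ(β+1) sin(βπ/2)) + O(|θ|^{β + (2−β)/2}) as θ → 0. -/

import Mathlib

open MeasureTheory Complex Asymptotics Filter

lemma integrable_of_integral_ne_zero {α : Type*} [MeasurableSpace α] {μ : Measure α} {f : α → ℝ}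
    (h : ∫ x, f x ∂μ ≠ 0) : Integrable f μ :=
  not_imp_comm.1 integral_undef h

lemma lintegral_ofReal_of_integral_eq {f : ℝ → ℝ} {v : ℝ} (hf : ∀ t, 0 < t → 0 ≤ f t)
    (hv : v ≠ 0) (h : ∫ t in Set.Ioi (0 : ℝ), f t = v) :
    ∫⁻ t in Set.Ioi (0 : ℝ), ENNReal.ofReal (f t) = ENNReal.ofReal v := by
  rw [← h, ofReal_integral_eq_lintegral_ofReal
    (integrable_of_integral_ne_zero (h.trans_ne hv))]
  exact (ae_restrict_iff' measurableSet_Ioi).2 (ae_of_all _ hf)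

lemma integral_rpow_div_sq_add {β c : ℝ} (h0 : 0 < β) (h2 : β < 2) (hc : 0 < c) :
    ∫ t in Set.Ioi (0 : ℝ), t ^ (β - 1) / (t ^ 2 + c) =
      c ^ (β / 2 - 1) * (Real.pi / (2 * Real.sin (β * Real.pi / 2))) := by
  have hΓ₁ : 0 < Real.Gamma (β / 2) := Real.Gamma_pos_of_pos (by linarith)
  have hΓ₂ : 0 < Real.Gamma (1 - β / 2) := Real.Gamma_pos_of_pos (by linarith)
  have key : ∫⁻ t in Set.Ioi (0 : ℝ), ENNReal.ofReal (t ^ (β - 1) / (t ^ 2 + c)) =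
      ENNReal.ofReal (1 / 2 * Real.Gamma (β / 2) *
        (c ^ (β / 2 - 1) * Real.Gamma (1 - β / 2))) := by
    calc _ = ∫⁻ t in Set.Ioi (0 : ℝ), ∫⁻ y in Set.Ioi (0 : ℝ),
            ENNReal.ofReal (t ^ (β - 1) * Real.exp (-(y * (t ^ 2 + c)))) := by
          refine setLIntegral_congr_fun measurableSet_Ioi fun t ht => ?_
          have ht : 0 < t := ht
          refine (lintegral_ofReal_of_integral_eq (fun y _ => by positivity) (by positivity) ?_).symm
          rw [integral_const_mul]
          have := Real.integral_rpow_mul_exp_neg_mul_Ioi one_pos (r := t ^ 2 + c) (by positivity)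
          simp only [sub_self, Real.rpow_zero, one_mul, Real.rpow_one, Real.Gamma_one,
            mul_one] at this
          simp only [mul_comm _ (t ^ 2 + c), this]
          ring
      _ = ∫⁻ y in Set.Ioi (0 : ℝ), ∫⁻ t in Set.Ioi (0 : ℝ),
            ENNReal.ofReal (t ^ (β - 1) * Real.exp (-(y * (t ^ 2 + c)))) := by
          refine lintegral_lintegral_swap (Measurable.aemeasurable ?_)
          unfold Function.uncurry
          fun_prop
      _ = ∫⁻ y in Set.Ioi (0 : ℝ), ENNReal.ofReal (1 / 2 * Real.Gamma (β / 2) *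
            (y ^ ((1 - β / 2) - 1) * Real.exp (-(c * y)))) := by
          refine setLIntegral_congr_fun measurableSet_Ioi fun y hy => ?_
          have hy : 0 < y := hy
          refine lintegral_ofReal_of_integral_eq (fun t ht => by positivity) (by positivity) ?_
          have := integral_rpow_mul_exp_neg_mul_rpow (p := 2) (q := β - 1) two_pos
            (by linarith) hy
          simp only [mul_add, neg_add, Real.exp_add, ← mul_assoc, integral_mul_const]
          simp only [Real.rpow_two, sub_add_cancel, neg_mul] at this ⊢
          rw [this, show 1 - β / 2 - 1 = -β / 2 by ring, mul_comm y c]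
          ring
      _ = _ := by
          refine lintegral_ofReal_of_integral_eq (fun t ht => by positivity) (by positivity) ?_
          rw [integral_const_mul, Real.integral_rpow_mul_exp_neg_mul_Ioi (by linarith) hc,
            one_div c, Real.inv_rpow hc.le, ← Real.rpow_neg hc.le, neg_sub]
  rw [integral_eq_lintegral_of_nonneg_ae, key, ENNReal.toReal_ofReal (by positivity),
    show 1 / 2 * Real.Gamma (β / 2) * (c ^ (β / 2 - 1) * Real.Gamma (1 - β / 2)) =
      c ^ (β / 2 - 1) * (1 / 2 * (Real.Gamma (β / 2) * Real.Gamma (1 - β / 2))) by ring,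
    Real.Gamma_mul_Gamma_one_sub, show Real.pi * (β / 2) = β * Real.pi / 2 by ring]
  · ring
  · refine (ae_restrict_iff' measurableSet_Ioi).2 (ae_of_all _ fun t ht => ?_)
    have ht : 0 < t := ht
    simp only [Pi.zero_apply]
    positivity
  · exact Measurable.aestronglyMeasurable (by fun_prop)

lemma hasSum_one_sub_cos_mul_exp {t : ℝ} (ht : 0 < t) (θ : ℝ) :
    HasSum (fun k : ℕ => (1 - Real.cos ((k + 1) * θ)) * Real.exp (-((k + 1) * t)))
      (Real.sinh t * (1 - Real.cos θ) /
        (2 * (Real.cosh t - 1) * (Real.cosh t - Real.cos θ))) := by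
  have hr0 := Real.exp_pos (-t)
  have hr1 : Real.exp (-t) < 1 := by simpa using ht
  set z : ℂ := Complex.exp (-t + θ * I) with hz
  have hzn : ‖z‖ < 1 := by simpa [hz, Complex.norm_exp] using ht
  have h1 := (hasSum_geometric_of_lt_one hr0.le hr1).mul_right (Real.exp (-t))
  have h2 := Complex.hasSum_re ((hasSum_geometric_of_norm_lt_one hzn).mul_right z)
  have h := h1.sub h2
  have hre : z.re = Real.exp (-t) * Real.cos θ := by simp [hz, Complex.exp_re]
  have him : z.im = Real.exp (-t) * Real.sin θ := by simp [hz, Complex.exp_im]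
  convert! h using 1
  · funext k
    rw [← pow_succ, ← pow_succ, ← Real.exp_nat_mul, hz, ← Complex.exp_nat_mul, Complex.exp_re]
    simp
    ring_nf
  · have hd : 0 < Real.cosh t - 1 := by
      have := Real.one_lt_cosh.2 ht.ne'
      linarith
    have hd2 : 0 < Real.cosh t - Real.cos θ := by linarith [Real.cos_le_one θ]
    have hsc := Real.sin_sq_add_cos_sq θ
    have hN : Complex.normSq (1 - z) =
        1 - 2 * Real.exp (-t) * Real.cos θ + Real.exp (-t) ^ 2 := by
      rw [Complex.normSq_apply]
      simp only [Complex.sub_re, Complex.sub_im, hre, him, Complex.one_re, Complex.one_im]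
      linear_combination Real.exp (-t) ^ 2 * hsc
    rw [Complex.mul_re, Complex.inv_re, Complex.inv_im, hN]
    simp only [Complex.sub_re, Complex.sub_im, hre, him, Complex.one_re, Complex.one_im]
    rw [Real.cosh_eq] at hd2
    rw [Real.sinh_eq, Real.cosh_eq]
    set r := Real.exp (-t) with hr
    have he : Real.exp t = r⁻¹ := by rw [hr, Real.exp_neg, inv_inv]
    rw [he] at hd2 ⊢
    have e1 : (r⁻¹ + r) / 2 - 1 = (1 - r) ^ 2 / (2 * r) := by field_simp; ring
    have e2 : (r⁻¹ + r) / 2 - Real.cos θ = (1 - 2 * r * Real.cos θ + r ^ 2) / (2 * r) := by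
      field_simp; ring
    have e3 : (r⁻¹ - r) / 2 = (1 - r) * (1 + r) / (2 * r) := by field_simp; ring
    have hD : 0 < 1 - 2 * r * Real.cos θ + r ^ 2 := by
      rw [e2] at hd2
      exact (div_pos_iff_of_pos_right (by positivity)).1 hd2
    have hr1' : 1 - r ≠ 0 := by linarith
    rw [e1, e2, e3]
    generalize hDd : 1 - 2 * r * Real.cos θ + r ^ 2 = D at *
    field_simp
    linear_combination hDd - (1 - r) * r * hsc

lemma abs_sub_le_of_le_one {A B s t q : ℝ} (ht : 0 < t) (hA₁ : t ^ 2 ≤ A)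
    (hA₂ : A ≤ t ^ 2 + t ^ 4) (hs : |t * s - A| ≤ t ^ 4) (hB₀ : 0 ≤ B) (hB₁ : B ≤ q)
    (hB₂ : q - B ≤ q ^ 2) :
    |s * B / (A * (A + B)) - q / (t * (t ^ 2 + q))| ≤ 2 * q / t := by
  have ht2 : 0 < t ^ 2 := by positivity
  have hA : 0 < A := by linarith
  have hq : 0 ≤ q := hB₀.trans hB₁
  have hAB : 0 < A + B := by linarith
  have htq : 0 < t ^ 2 + q := by linarith
  have e : s * B / (A * (A + B)) - q / (t * (t ^ 2 + q)) =
      (t * s - A) * B / (t * A * (A + B)) +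
        (B * t ^ 2 - A * q) / (t * ((A + B) * (t ^ 2 + q))) := by
    field_simp
    ring
  have b₁ : |(t * s - A) * B / (t * A * (A + B))| ≤ q / t := by
    rw [abs_div, abs_mul, abs_of_nonneg hB₀, abs_of_pos (by positivity : 0 < t * A * (A + B))]
    calc |t * s - A| * B / (t * A * (A + B)) ≤ t ^ 4 * q / (t * t ^ 2 * t ^ 2) := by
          gcongr
          linarith
      _ = q / t := by field_simp
  have b₂ : |(B * t ^ 2 - A * q) / (t * ((A + B) * (t ^ 2 + q)))| ≤ q / t := by
    rw [abs_div, abs_of_pos (by positivity : 0 < t * ((A + B) * (t ^ 2 + q)))]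
    have hn : |B * t ^ 2 - A * q| ≤ q * (t ^ 2 * (t ^ 2 + q)) := by
      rw [abs_le]
      constructor <;>
        nlinarith [mul_le_mul_of_nonneg_right hA₂ hq, mul_le_mul_of_nonneg_right hB₂ ht2.le,
          mul_le_mul_of_nonneg_right hA₁ hq, mul_le_mul_of_nonneg_right hB₁ ht2.le,
          mul_nonneg hq ht2.le, mul_nonneg (mul_nonneg hq hq) ht2.le,
          mul_nonneg hq (sq_nonneg (t ^ 2))]
    calc |B * t ^ 2 - A * q| / (t * ((A + B) * (t ^ 2 + q)))
        ≤ q * (t ^ 2 * (t ^ 2 + q)) / (t * (t ^ 2 * (t ^ 2 + q))) := by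
          gcongr
          linarith
      _ = q / t := by field_simp
  rw [e]
  calc _ ≤ _ := abs_add_le _ _
    _ ≤ q / t + q / t := add_le_add b₁ b₂
    _ = 2 * q / t := by ring

lemma cosh_sinh_bounds {t : ℝ} (ht : 0 < t) (ht1 : t ≤ 1) :
    |Real.cosh t - (1 + t ^ 2 / 2)| ≤ t ^ 4 * (5 / 96) ∧
      |Real.sinh t - (t + t ^ 3 / 6)| ≤ t ^ 4 * (5 / 96) := by
  have h₁ := Real.exp_bound (x := t) (n := 4) (by rwa [abs_of_pos ht]) (by norm_num)
  have h₂ := Real.exp_bound (x := -t) (n := 4) (by rwa [abs_neg, abs_of_pos ht]) (by norm_num)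
  rw [abs_neg] at h₂
  simp only [Finset.sum_range_succ, Finset.sum_range_zero, Nat.factorial, abs_of_pos ht] at h₁ h₂
  norm_num at h₁ h₂
  rw [abs_le] at h₁ h₂
  rw [Real.cosh_eq, Real.sinh_eq, abs_le, abs_le]
  refine ⟨⟨?_, ?_⟩, ?_, ?_⟩ <;> nlinarith

lemma one_add_le_cosh (t : ℝ) : 1 + t ^ 2 / 2 + t ^ 4 / 24 ≤ Real.cosh t := by
  have h := sum_le_hasSum (Finset.range 3)
    (fun n _ => by rw [pow_mul]; positivity) (Real.hasSum_cosh t)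
  simpa [Finset.sum_range_succ, Nat.factorial] using h

lemma abs_kernel_sub_le {t θ : ℝ} (ht : 0 < t) (hθ : |θ| ≤ 1) :
    |Real.sinh t * (1 - Real.cos θ) / (2 * (Real.cosh t - 1) * (Real.cosh t - Real.cos θ)) -
      θ ^ 2 / (t * (t ^ 2 + θ ^ 2))| ≤ 36 * θ ^ 2 * (1 / (t * (t ^ 2 + 1))) := by
  have hch := one_add_le_cosh t
  have ht2 : 0 < t ^ 2 := by positivity
  have ht4 : 0 < t ^ 4 := by positivity
  set A := 2 * (Real.cosh t - 1) with hA
  set B := 2 * (1 - Real.cos θ) with hB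
  have hAt : t ^ 2 ≤ A := by linarith
  have hAt4 : t ^ 4 / 12 ≤ A := by linarith
  have hApos : 0 < A := by linarith
  have hB₀ : 0 ≤ B := by linarith [Real.cos_le_one θ]
  have hB₁ : B ≤ θ ^ 2 := by linarith [Real.one_sub_sq_div_two_le_cos (x := θ)]
  have e : Real.sinh t * (1 - Real.cos θ) / (A * (Real.cosh t - Real.cos θ)) =
      Real.sinh t * B / (A * (A + B)) := by
    rw [show A + B = 2 * (Real.cosh t - Real.cos θ) by rw [hA, hB]; ring, hB,
      show Real.sinh t * (2 * (1 - Real.cos θ)) = 2 * (Real.sinh t * (1 - Real.cos θ)) by ring,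
      mul_left_comm A 2, mul_div_mul_left _ _ two_ne_zero]
  rw [e]
  rcases le_total t 1 with h1 | h1
  · obtain ⟨hc, hs⟩ := cosh_sinh_bounds ht h1
    have hcos := Real.cos_bound hθ
    rw [Even.pow_abs (by decide)] at hcos
    rw [abs_le] at hc hs hcos
    refine (abs_sub_le_of_le_one ht hAt (by linarith) ?_ hB₀ hB₁ ?_).trans ?_
    · have h5 : t ^ 5 ≤ t ^ 4 := pow_le_pow_of_le_one ht.le h1 (by norm_num)
      rw [abs_le]
      constructor <;> nlinarith
    · nlinarith [sq_nonneg (θ ^ 2)]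
    · rw [mul_one_div, div_le_div_iff₀ ht (by positivity)]
      have : t ^ 2 ≤ 1 := pow_le_one₀ ht.le h1
      nlinarith [mul_nonneg (sq_nonneg θ) ht.le]
  · have hs0 : 0 < Real.sinh t := Real.sinh_pos_iff.2 ht
    have ht21 : 1 ≤ t ^ 2 := one_le_pow₀ h1
    have hs : Real.sinh t ≤ 3 / 2 * A := by linarith [Real.sinh_lt_cosh t]
    have hb : 18 * θ ^ 2 / t ^ 3 ≤ 36 * θ ^ 2 * (1 / (t * (t ^ 2 + 1))) := by
      rw [mul_one_div, div_le_div_iff₀ (by positivity) (by positivity)]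
      nlinarith [mul_nonneg (mul_nonneg (sq_nonneg θ) ht.le) (sub_nonneg.2 ht21)]
    have h₁ : Real.sinh t * B / (A * (A + B)) ≤ 18 * θ ^ 2 / t ^ 3 := by
      calc Real.sinh t * B / (A * (A + B)) ≤ 3 / 2 * A * θ ^ 2 / (A * (t ^ 4 / 12)) := by
            gcongr
            linarith
        _ = 18 * θ ^ 2 / t ^ 4 := by field_simp; ring
        _ ≤ 18 * θ ^ 2 / t ^ 3 := by
            gcongr
            norm_num
    have h₂ : θ ^ 2 / (t * (t ^ 2 + θ ^ 2)) ≤ 18 * θ ^ 2 / t ^ 3 := by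
      calc θ ^ 2 / (t * (t ^ 2 + θ ^ 2)) ≤ 18 * θ ^ 2 / (t * t ^ 2) := by
            gcongr
            · linarith [sq_nonneg θ]
            · linarith [sq_nonneg θ]
        _ = 18 * θ ^ 2 / t ^ 3 := by rw [← pow_succ']
    refine (abs_sub_le_of_nonneg_of_le (by positivity) h₁ (by positivity) h₂).trans hb

lemma summable_add_one_rpow {β : ℝ} (hβ : 0 < β) :
    Summable fun k : ℕ => ((k : ℝ) + 1) ^ (-(β + 1)) := by
  have := (summable_nat_add_iff 1).2 (Real.summable_nat_rpow.2 (by linarith : -(β + 1) < -1))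
  simpa using this

lemma hasSum_one_sub_cos_mul_rpow {β : ℝ} (hβ : 0 < β) (θ : ℝ) :
    HasSum (fun k : ℕ => (1 - Real.cos ((k + 1) * θ)) *
        (((k : ℝ) + 1) ^ (-(β + 1)) * Real.Gamma (β + 1)))
      (∫ t in Set.Ioi (0 : ℝ), t ^ β * (Real.sinh t * (1 - Real.cos θ) /
        (2 * (Real.cosh t - 1) * (Real.cosh t - Real.cos θ)))) := by
  have hΓ : 0 < Real.Gamma (β + 1) := Real.Gamma_pos_of_pos (by linarith)
  set F : ℕ → ℝ → ℝ := fun k t =>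
    t ^ β * ((1 - Real.cos ((k + 1) * θ)) * Real.exp (-((k + 1) * t))) with hF
  have hbase (k : ℕ) : ∫ t in Set.Ioi (0 : ℝ), t ^ β * Real.exp (-((k + 1) * t)) =
      ((k : ℝ) + 1) ^ (-(β + 1)) * Real.Gamma (β + 1) := by
    have hk : (0 : ℝ) < k + 1 := by positivity
    have := Real.integral_rpow_mul_exp_neg_mul_Ioi (a := β + 1) (by linarith) hk
    rw [add_sub_cancel_right] at this
    rw [this, one_div, Real.inv_rpow hk.le, Real.rpow_neg hk.le]
  have hFe (k : ℕ) : F k = fun t => (1 - Real.cos ((k + 1) * θ)) *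
      (t ^ β * Real.exp (-((k + 1) * t))) := by
    funext t; simp only [hF]; ring
  have hint (k : ℕ) : ∫ t in Set.Ioi (0 : ℝ), F k t = (1 - Real.cos ((k + 1) * θ)) *
      (((k : ℝ) + 1) ^ (-(β + 1)) * Real.Gamma (β + 1)) := by
    rw [hFe, integral_const_mul, hbase]
  have hnorm (k : ℕ) : ∫ t in Set.Ioi (0 : ℝ), ‖F k t‖ = ∫ t in Set.Ioi (0 : ℝ), F k t := by
    refine setIntegral_congr_fun measurableSet_Ioi fun t ht => ?_
    have ht : 0 < t := ht
    have := sub_nonneg.2 (Real.cos_le_one ((k + 1) * θ))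
    exact Real.norm_of_nonneg (by positivity)
  have hsum := summable_add_one_rpow hβ
  have h := hasSum_integral_of_summable_integral_norm (F := F)
    (μ := volume.restrict (Set.Ioi 0)) (fun k => ?_) ?_
  · simp only [hint] at h
    convert! h using 1
    refine setIntegral_congr_fun measurableSet_Ioi fun t ht => ?_
    exact ((hasSum_one_sub_cos_mul_exp ht θ).mul_left (t ^ β)).tsum_eq.symm
  · rw [hFe]
    refine (integrable_of_integral_ne_zero ?_).const_mul _
    rw [hbase]
    positivity
  · simp only [hnorm, hint]
    refine Summable.of_nonneg_of_le (fun k => ?_) (fun k => ?_)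
      ((hsum.mul_right (Real.Gamma (β + 1))).mul_left 2)
    · have := sub_nonneg.2 (Real.cos_le_one ((k + 1) * θ))
      positivity
    · gcongr
      linarith [Real.neg_one_le_cos ((k + 1) * θ)]

lemma integrableOn_rpow_div_sq_add {β c : ℝ} (h0 : 0 < β) (h2 : β < 2) (hc : 0 < c) :
    IntegrableOn (fun t : ℝ => t ^ (β - 1) / (t ^ 2 + c)) (Set.Ioi 0) := by
  refine integrable_of_integral_ne_zero ?_
  rw [integral_rpow_div_sq_add h0 h2 hc]
  have : 0 < Real.sin (β * Real.pi / 2) :=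
    Real.sin_pos_of_pos_of_lt_pi (by positivity) (by nlinarith [Real.pi_pos])
  positivity

lemma abs_tsum_one_sub_cos_sub_le {β : ℝ} (h0 : 0 < β) (h2 : β < 2) {θ : ℝ} (hθ : |θ| ≤ 1) :
    |(∑' k : ℕ, (1 - Real.cos ((k + 1) * θ)) * ((k : ℝ) + 1) ^ (-(β + 1))) -
      Real.pi / 2 * |θ| ^ β / (Real.Gamma (β + 1) * Real.sin (β * Real.pi / 2))| ≤
      36 * (Real.pi / (2 * Real.sin (β * Real.pi / 2))) / Real.Gamma (β + 1) * θ ^ 2 := by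
  rcases eq_or_ne θ 0 with rfl | hne
  · simp [Real.zero_rpow h0.ne']
  have hΓ : 0 < Real.Gamma (β + 1) := Real.Gamma_pos_of_pos (by linarith)
  have hsum := (hasSum_one_sub_cos_mul_rpow h0 θ).div_const (Real.Gamma (β + 1))
  simp only [mul_div_assoc, div_self hΓ.ne', mul_one] at hsum
  rw [hsum.tsum_eq]
  set S : ℝ → ℝ := fun t => t ^ β * (Real.sinh t * (1 - Real.cos θ) /
    (2 * (Real.cosh t - 1) * (Real.cosh t - Real.cos θ))) with hS
  set M : ℝ → ℝ := fun t => θ ^ 2 * (t ^ (β - 1) / (t ^ 2 + θ ^ 2)) with hM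
  have hθ2 : 0 < θ ^ 2 := by positivity
  have hMint : IntegrableOn M (Set.Ioi 0) := (integrableOn_rpow_div_sq_add h0 h2 hθ2).const_mul _
  have hG : IntegrableOn (fun t : ℝ => 36 * θ ^ 2 * (t ^ (β - 1) / (t ^ 2 + 1))) (Set.Ioi 0) :=
    (integrableOn_rpow_div_sq_add h0 h2 one_pos).const_mul _
  have hbound : ∀ᵐ t ∂volume.restrict (Set.Ioi (0 : ℝ)),
      ‖S t - M t‖ ≤ 36 * θ ^ 2 * (t ^ (β - 1) / (t ^ 2 + 1)) := by
    refine (ae_restrict_iff' measurableSet_Ioi).2 (ae_of_all _ fun t (ht : 0 < t) => ?_)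
    have hk := mul_le_mul_of_nonneg_left (abs_kernel_sub_le ht hθ) (Real.rpow_nonneg ht.le β)
    rw [← abs_of_nonneg (Real.rpow_nonneg ht.le β), ← abs_mul,
      abs_of_nonneg (Real.rpow_nonneg ht.le β)] at hk
    have hp : t ^ β = t * t ^ (β - 1) := by
      rw [Real.rpow_sub_one ht.ne']; field_simp
    rw [Real.norm_eq_abs]
    convert! hk using 1
    · congr 1
      simp only [hS, hM, hp]
      field_simp
    · rw [hp]
      field_simp
  have hSm : AEStronglyMeasurable S (volume.restrict (Set.Ioi 0)) :=
    Measurable.aestronglyMeasurable (by fun_prop)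
  have hD : IntegrableOn (fun t => S t - M t) (Set.Ioi 0) :=
    Integrable.mono' hG (hSm.sub hMint.1) hbound
  have hSint : IntegrableOn S (Set.Ioi 0) := by
    exact (hD.add hMint).congr (ae_of_all _ fun t => sub_add_cancel (S t) (M t))
  have hle := norm_integral_le_of_norm_le hG hbound
  rw [integral_sub hSint hMint, integral_const_mul, integral_const_mul,
    integral_rpow_div_sq_add h0 h2 hθ2, integral_rpow_div_sq_add h0 h2 one_pos,
    Real.one_rpow, one_mul, Real.norm_eq_abs] at hle
  have hpow : θ ^ 2 * (θ ^ 2) ^ (β / 2 - 1) = |θ| ^ β := by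
    rw [Real.rpow_sub_one hθ2.ne', mul_div_cancel₀ _ hθ2.ne', ← sq_abs, ← Real.rpow_two,
      ← Real.rpow_mul (abs_nonneg _)]
    congr 1
    ring
  rw [← mul_assoc, hpow] at hle
  have e : (∫ t in Set.Ioi (0 : ℝ), S t) / Real.Gamma (β + 1) -
      Real.pi / 2 * |θ| ^ β / (Real.Gamma (β + 1) * Real.sin (β * Real.pi / 2)) =
      ((∫ t in Set.Ioi (0 : ℝ), S t) -
        |θ| ^ β * (Real.pi / (2 * Real.sin (β * Real.pi / 2)))) / Real.Gamma (β + 1) := by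
    rw [sub_div]
    congr 1
    rw [mul_comm (Real.Gamma _), ← div_div]
    congr 1
    rw [← div_div, mul_div_assoc, mul_comm, mul_div_assoc, mul_comm, mul_comm (|θ| ^ β)]
    ring
  simp only [hS, mul_div_assoc] at e hle ⊢
  rw [e, abs_div, abs_of_pos hΓ, div_le_iff₀ hΓ]
  refine hle.trans_eq ?_
  field_simp

theorem charFun_expansion_power_law {Ω : Type*} [MeasurableSpace Ω] (μ : Measure Ω)
    [IsProbabilityMeasure μ] (X : Ω → ℤ) (hX : Measurable X)
    (β a : ℝ) (hβ : β ∈ Set.Ioo (0 : ℝ) 2)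
    (ha : (∑' k : ℕ, ((k : ℝ) + 1) ^ (-(β + 1))) < a)
    (hk : ∀ k : ℤ, k ≠ 0 →
      μ {ω | X ω = k} = ENNReal.ofReal (1 / (2 * a * (|k| : ℝ) ^ (β + 1))))
    (h0 : μ {ω | X ω = 0} =
      ENNReal.ofReal (1 - (1 / a) * ∑' k : ℕ, ((k : ℝ) + 1) ^ (-(β + 1))))
    (φ : ℝ → ℂ)
    (hφ : ∀ θ : ℝ, φ θ = ∑' k : ℤ,
        Complex.exp (θ * k * Complex.I) * ((μ {ω | X ω = k}).toReal : ℂ)) :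
    (fun θ : ℝ => φ θ -
        ((1 - (Real.pi / (2 * a)) * |θ| ^ β /
            (Real.Gamma (β + 1) * Real.sin (β * Real.pi / 2)) : ℝ) : ℂ)) =O[nhds 0]
      fun θ : ℝ => |θ| ^ (β + (2 - β) / 2) := by
  obtain ⟨hβ0, hβ2⟩ := hβ
  have hw : Summable fun k : ℕ => ((k : ℝ) + 1) ^ (-(β + 1)) := summable_add_one_rpow hβ0
  have ha0 : 0 < a := (tsum_nonneg fun k => by positivity).trans_lt ha
  have hp (k : ℤ) (n : ℕ) (h : |(k : ℝ)| = n + 1) :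
      (μ {ω | X ω = k}).toReal = ((n : ℝ) + 1) ^ (-(β + 1)) / (2 * a) := by
    have hn : (0 : ℝ) < n + 1 := by positivity
    have hk0 : k ≠ 0 := by
      rintro rfl
      simp only [Int.cast_zero, abs_zero] at h
      linarith
    rw [hk k hk0, h, ENNReal.toReal_ofReal (by positivity), Real.rpow_neg hn.le]
    field_simp
  have hp0 : (μ {ω | X ω = 0}).toReal =
      1 - (1 / a) * ∑' k : ℕ, ((k : ℝ) + 1) ^ (-(β + 1)) := by
    rw [h0, ENNReal.toReal_ofReal]
    rw [one_div, inv_mul_eq_div, sub_nonneg, div_le_one ha0]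
    exact ha.le
  have hφ' (θ : ℝ) : φ θ = ((1 - (1 / a) *
      ∑' k : ℕ, (1 - Real.cos ((k + 1) * θ)) * ((k : ℝ) + 1) ^ (-(β + 1)) : ℝ) : ℂ) := by
    rw [hφ]
    set f : ℤ → ℂ := fun k =>
      Complex.exp (θ * k * Complex.I) * ((μ {ω | X ω = k}).toReal : ℂ) with hf
    have hn (k : ℤ) : ‖f k‖ = (μ {ω | X ω = k}).toReal := by
      rw [hf, norm_mul, ← Complex.ofReal_intCast, ← Complex.ofReal_mul,
        Complex.norm_exp_ofReal_mul_I, one_mul, Complex.norm_real,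
        Real.norm_of_nonneg ENNReal.toReal_nonneg]
    have habs₁ (n : ℕ) : |(((n : ℤ) + 1 : ℤ) : ℝ)| = n + 1 := by
      push_cast
      exact abs_of_pos (by positivity)
    have habs₂ (n : ℕ) : |((-((n : ℤ) + 1) : ℤ) : ℝ)| = n + 1 := by
      rw [Int.cast_neg, abs_neg, habs₁]
    have hs₁ : Summable fun n : ℕ => f (n + 1) := by
      refine Summable.of_norm ?_
      simp only [hn, hp _ _ (habs₁ _)]
      exact hw.div_const _
    have hs₂ : Summable fun n : ℕ => f (-(n + 1)) := by
      refine Summable.of_norm ?_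
      simp only [hn, hp _ _ (habs₂ _)]
      exact hw.div_const _
    have hcos : Summable fun k : ℕ => Real.cos ((k + 1) * θ) * ((k : ℝ) + 1) ^ (-(β + 1)) := by
      refine Summable.of_norm_bounded hw fun k => ?_
      rw [norm_mul, Real.norm_eq_abs, Real.norm_of_nonneg (by positivity)]
      exact mul_le_of_le_one_left (by positivity) (Real.abs_cos_le_one _)
    have hpair (n : ℕ) : f (n + 1) + f (-(n + 1)) =
        ((1 / a * (Real.cos ((n + 1) * θ) * ((n : ℝ) + 1) ^ (-(β + 1))) : ℝ) : ℂ) := by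
      simp only [hf, hp _ _ (habs₁ _), hp _ _ (habs₂ _)]
      have h2 := Complex.two_cos (((n : ℂ) + 1) * θ)
      push_cast
      rw [← add_mul, show (θ : ℂ) * (n + 1) * I = (n + 1) * θ * I by ring,
        show (θ : ℂ) * -(n + 1) * I = -((n + 1) * θ) * I by ring, ← h2]
      field_simp
    have htsum := tsum_of_add_one_of_neg_add_one hs₁ hs₂
    rw [htsum, add_right_comm, ← hs₁.tsum_add hs₂, tsum_congr hpair, ← Complex.ofReal_tsum,
      tsum_mul_left]
    have hf0 : f 0 = ((1 - (1 / a) * ∑' k : ℕ, ((k : ℝ) + 1) ^ (-(β + 1)) : ℝ) : ℂ) := by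
      simp only [hf, hp0]
      simp
    simp only [sub_mul, one_mul]
    rw [hf0, hw.tsum_sub hcos, ← Complex.ofReal_add]
    congr 1
    ring
  have hsq : (fun θ : ℝ => φ θ -
        ((1 - (Real.pi / (2 * a)) * |θ| ^ β /
            (Real.Gamma (β + 1) * Real.sin (β * Real.pi / 2)) : ℝ) : ℂ)) =O[nhds 0]
      fun θ : ℝ => θ ^ 2 := by
    refine IsBigO.of_bound
      (1 / a * (36 * (Real.pi / (2 * Real.sin (β * Real.pi / 2))) / Real.Gamma (β + 1))) ?_
    filter_upwards [Metric.closedBall_mem_nhds (0 : ℝ) one_pos] with θ hθ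
    have hθ : |θ| ≤ 1 := by simpa using hθ
    have key := abs_tsum_one_sub_cos_sub_le hβ0 hβ2 hθ
    rw [hφ', ← Complex.ofReal_sub, Complex.norm_real, Real.norm_eq_abs, Real.norm_eq_abs,
      abs_of_nonneg (sq_nonneg θ), abs_sub_comm, mul_assoc]
    refine le_trans (le_of_eq ?_) (mul_le_mul_of_nonneg_left key (one_div_pos.2 ha0).le)
    rw [← abs_of_pos (one_div_pos.2 ha0), ← abs_mul, abs_of_pos (one_div_pos.2 ha0)]
    congr 1
    ring
  refine hsq.trans (IsBigO.of_bound 1 ?_)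
  filter_upwards [Metric.closedBall_mem_nhds (0 : ℝ) one_pos] with θ hθ
  have hθ : |θ| ≤ 1 := by simpa using hθ
  rw [one_mul, Real.norm_of_nonneg (sq_nonneg θ), Real.norm_of_nonneg (by positivity),
    ← sq_abs, ← Real.rpow_two]
  exact Real.rpow_le_rpow_of_exponent_ge_of_imp (abs_nonneg θ) hθ (by linarith)
    fun _ h => absurd h (by linarith)
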